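/- Let c > 0 and p ∈ [1/2, 1). Suppose V : [0,∞) → ℝ is differentiable, V(t) ≥ 0 for all t ≥ 0, and V′(t) ≤ −c V(t)^p for all t ≥ 0. Then V(t) = 0 for every t > V(0)^{1−p} / (c(1−p)). -/

import Mathlib

/-- As long as `V` stays positive, `V' ≤ -c V^p` makes `V^(1-p)` decay at least linearly. -/
theorem rpow_add_mul_le_of_deriv_le {c p t : ℝ} (hp1 : p ≤ 1) (ht : 0 ≤ t) {V V' : ℝ → ℝ}
    (hderiv : ∀ s ∈ Set.Icc 0 t, HasDerivWithinAt V (V' s) (Set.Icc 0 t) s)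
    (hpos : ∀ s ∈ Set.Icc 0 t, 0 < V s)
    (hineq : ∀ s ∈ Set.Icc 0 t, V' s ≤ -c * V s ^ p) :
    V t ^ (1 - p) + c * (1 - p) * t ≤ V 0 ^ (1 - p) := by
  have hW : ∀ s ∈ Set.Icc 0 t, HasDerivWithinAt (fun s => V s ^ (1 - p) + c * (1 - p) * s)
      (V' s * (1 - p) * V s ^ (1 - p - 1) + c * (1 - p) * 1) (Set.Icc 0 t) s := fun s hs =>
    ((hderiv s hs).rpow_const (Or.inl (hpos s hs).ne')).add
      ((hasDerivWithinAt_id s _).const_mul _)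
  have hanti := antitoneOn_of_hasDerivWithinAt_nonpos (convex_Icc 0 t)
    (fun s hs => (hW s hs).continuousWithinAt)
    (fun s hs => (hW s (interior_subset hs)).mono interior_subset) fun s hs => by
      have hs := interior_subset hs
      have hV := hpos s hs
      have hmul : V s ^ p * V s ^ (1 - p - 1) = 1 := by
        rw [← Real.rpow_add hV]; simp
      have hle : V' s * V s ^ (1 - p - 1) ≤ -c := by
        calc V' s * V s ^ (1 - p - 1) ≤ -c * V s ^ p * V s ^ (1 - p - 1) := by
              gcongr
              exact hineq s hs
          _ = -c := by rw [mul_assoc, hmul, mul_one]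
      nlinarith [mul_le_mul_of_nonneg_right hle (sub_nonneg.2 hp1)]
  simpa using hanti (Set.left_mem_Icc.2 ht) (Set.right_mem_Icc.2 ht) ht


/-- Finite-time extinction (comparison) lemma underlying the finite-time consensus
theorem: a nonnegative differentiable Lyapunov function `V` on `[0,∞)` with
`V' ≤ -c V^p`, `c > 0`, `p ∈ [1/2, 1)`, vanishes for all `t > V(0)^(1-p)/(c(1-p))`. -/
theorem stmt14 {c p : ℝ} (hc : 0 < c) (hp : 1 / 2 ≤ p) (hp1 : p < 1)
    (V V' : ℝ → ℝ)
    (hderiv : ∀ t ≥ (0 : ℝ), HasDerivWithinAt V (V' t) (Set.Ici 0) t)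
    (hnn : ∀ t ≥ (0 : ℝ), 0 ≤ V t)
    (hineq : ∀ t ≥ (0 : ℝ), V' t ≤ -c * V t ^ p) :
    ∀ t : ℝ, V 0 ^ (1 - p) / (c * (1 - p)) < t → V t = 0 := by
  intro t ht
  have h1p : 0 < 1 - p := sub_pos.2 hp1
  have ht0 : 0 ≤ t :=
    (div_nonneg (Real.rpow_nonneg (hnn 0 le_rfl) _) (mul_pos hc h1p).le).trans ht.le
  have hanti : AntitoneOn V (Set.Ici 0) :=
    antitoneOn_of_hasDerivWithinAt_nonpos (convex_Ici 0)
      (fun s hs => (hderiv s hs).continuousWithinAt)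
      (fun s hs => (hderiv s (interior_subset hs)).mono interior_subset) fun s hs => by
        have hs : 0 ≤ s := interior_subset hs
        have := mul_nonneg hc.le (Real.rpow_nonneg (hnn s hs) p)
        linarith [hineq s hs]
  by_contra hne
  have hVt : 0 < V t := (hnn t ht0).lt_of_ne' hne
  have hdecay := rpow_add_mul_le_of_deriv_le hp1.le ht0
    (fun s hs => (hderiv s hs.1).mono Set.Icc_subset_Ici_self)
    (fun s hs => hVt.trans_le (hanti hs.1 ht0 hs.2)) (fun s hs => hineq s hs.1)
  rw [div_lt_iff₀ (mul_pos hc h1p)] at ht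
  linarith [Real.rpow_pos_of_pos hVt (1 - p)]
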